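/- There exists ε > 0 such that for all integers b ≥ 1, m ≥ 1 and all k < −b, P_k(𝔇_{β_m} ≥ k + b) ≥ ε; that is, inf_{b,m∈ℕ, k<−b} P_k(𝔇_{β_m} ≥ k+b) > 0. -/

import Mathlib

open MeasureTheory Filter ProbabilityTheory

noncomputable section

/-- One-step transition probability of the urn discrepancy chain with parameter `lam`:
from state `i`, jump to `i+1` with probability `lam^(2i-1)/(1+lam^(2i-1))` and to `i-1`
with probability `1/(1+lam^(2i-1))`. -/
def urnStep (lam : ℝ) (i j : ℤ) : ℝ :=
  if j = i + 1 then lam ^ (2 * i - 1) / (1 + lam ^ (2 * i - 1))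
  else if j = i - 1 then 1 / (1 + lam ^ (2 * i - 1))
  else 0

/-- `P` is the family of laws (indexed by the starting point) of the urn discrepancy
chain with parameter `lam`, characterized by its cylinder probabilities. -/
def IsUrnChain (lam : ℝ) (P : ℤ → Measure (ℕ → ℤ)) : Prop :=
  (∀ x, IsProbabilityMeasure (P x)) ∧
    ∀ (x : ℤ) (n : ℕ) (p : ℕ → ℤ),
      (P x {ω | ∀ i ≤ n, ω i = p i}).toReal =
        (if p 0 = x then (1 : ℝ) else 0) *
          ∏ i ∈ Finset.range n, urnStep lam (p i) (p (i + 1))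

/-- Number of down-steps of the path `ω` during the time interval `[1, j]`. -/
def downCount (ω : ℕ → ℤ) (j : ℕ) : ℕ :=
  ((Finset.Icc 1 j).filter fun ℓ => ω ℓ = ω (ℓ - 1) - 1).card

/-- `betaTime ω i` is the time of the `i`-th down-step of the path `ω`. -/
def betaTime (ω : ℕ → ℤ) (i : ℕ) : ℕ :=
  sInf {j | 1 ≤ j ∧ downCount ω j = i}

/-- The probability distribution `π(x) = lam^(x²) / Σ_y lam^(y²)` on `ℤ`. -/
def urnPi (lam : ℝ) (x : ℤ) : ℝ :=
  lam ^ (x ^ 2) / ∑' y : ℤ, lam ^ (y ^ 2)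

section Cylinders

/-- The paths that agree with `p` up to time `n`. -/
def cylinderSet (n : ℕ) (p : ℕ → ℤ) : Set (ℕ → ℤ) := {ω | ∀ i ≤ n, ω i = p i}

/-- The collection of all cylinder sets of integer paths, together with the empty set. -/
def cylinderSets : Set (Set (ℕ → ℤ)) := {s | s = ∅ ∨ ∃ n p, s = cylinderSet n p}

lemma measurableSet_cylinderSet (n : ℕ) (p : ℕ → ℤ) : MeasurableSet (cylinderSet n p) := by
  have h : cylinderSet n p = ⋂ i : ℕ, ⋂ _ : i ≤ n, (fun ω : ℕ → ℤ => ω i) ⁻¹' {p i} := by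
    ext ω
    simp [cylinderSet]
  rw [h]
  exact MeasurableSet.iInter fun i => MeasurableSet.iInter fun _ =>
    measurable_pi_apply i (measurableSet_singleton _)

lemma isPiSystem_cylinderSets : IsPiSystem cylinderSets := by
  have key : ∀ (n n' : ℕ) (p p' : ℕ → ℤ), n ≤ n' → (cylinderSet n p ∩ cylinderSet n' p').Nonempty →
      cylinderSet n p ∩ cylinderSet n' p' = cylinderSet n' p' := by
    rintro n n' p p' hn ⟨ω, h1, h2⟩
    refine Set.inter_eq_right.2 fun η hη i hi => ?_
    rw [hη i (hi.trans hn), ← h2 i (hi.trans hn), h1 i hi]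
  rintro s (rfl | ⟨n, p, rfl⟩) t (rfl | ⟨n', p', rfl⟩) hne
  · simp at hne
  · simp at hne
  · simp at hne
  · rcases le_total n n' with h | h
    · exact Or.inr ⟨n', p', key n n' p p' h hne⟩
    · refine Or.inr ⟨n, p, ?_⟩
      rw [Set.inter_comm] at hne ⊢
      exact key n' n p' p h hne

lemma generateFrom_cylinderSets :
    (inferInstance : MeasurableSpace (ℕ → ℤ)) = MeasurableSpace.generateFrom cylinderSets := by
  apply le_antisymm
  · refine iSup_le fun i => ?_
    rw [← measurable_iff_comap_le]
    refine @measurable_to_countable' ℤ (ℕ → ℤ) _ _ (MeasurableSpace.generateFrom cylinderSets)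
      _ fun a => ?_
    have h : (fun ω : ℕ → ℤ => ω i) ⁻¹' {a} =
        ⋃ q : Fin i → ℤ, cylinderSet i (fun l => if h : l < i then q ⟨l, h⟩ else a) := by
      ext ω
      simp only [Set.mem_preimage, Set.mem_singleton_iff, Set.mem_iUnion, cylinderSet,
        Set.mem_ofPred_eq]
      constructor
      · rintro rfl
        refine ⟨fun l => ω l, fun l hl => ?_⟩
        split_ifs with h
        · rfl
        · rw [show l = i by omega]
      · rintro ⟨q, hq⟩
        simpa using hq i le_rfl
    rw [h]
    exact MeasurableSet.iUnion fun q =>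
      MeasurableSpace.measurableSet_generateFrom (Or.inr ⟨_, _, rfl⟩)
  · refine MeasurableSpace.generateFrom_le ?_
    rintro s (rfl | ⟨n, p, rfl⟩)
    · exact MeasurableSet.empty
    · exact measurableSet_cylinderSet n p

end Cylinders

section Markov

lemma urnStep_nonneg {lam : ℝ} (h0 : 0 < lam) (i j : ℤ) : 0 ≤ urnStep lam i j := by
  have := zpow_pos h0 (2 * i - 1)
  unfold urnStep
  split_ifs <;> positivity

lemma urnStep_up (lam : ℝ) (i : ℤ) :
    urnStep lam i (i + 1) = lam ^ (2 * i - 1) / (1 + lam ^ (2 * i - 1)) := by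
  simp [urnStep]

lemma urnStep_down {lam : ℝ} (h0 : 0 < lam) (i : ℤ) :
    urnStep lam i (i - 1) = 1 - urnStep lam i (i + 1) := by
  have h := zpow_pos h0 (2 * i - 1)
  have h1 : ¬ (i - 1 = i + 1) := by omega
  rw [urnStep_up, urnStep, if_neg h1, if_pos rfl]
  field_simp
  ring

/-- The time shift on paths. -/
def pathShift (ω : ℕ → ℤ) : ℕ → ℤ := fun i => ω (i + 1)

lemma measurable_pathShift : Measurable pathShift :=
  measurable_pi_lambda _ fun i => measurable_pi_apply (i + 1)

variable {lam : ℝ} {P : ℤ → Measure (ℕ → ℤ)}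

lemma IsUrnChain.measure_cylinderSet (hP : IsUrnChain lam P) (x : ℤ) (n : ℕ) (p : ℕ → ℤ) :
    P x (cylinderSet n p) = ENNReal.ofReal ((if p 0 = x then (1 : ℝ) else 0) *
      ∏ i ∈ Finset.range n, urnStep lam (p i) (p (i + 1))) := by
  have := hP.1 x
  rw [← hP.2 x n p]
  exact (ENNReal.ofReal_toReal (measure_ne_top _ _)).symm

lemma IsUrnChain.map_pathShift (h0 : 0 < lam) (hP : IsUrnChain lam P) (y z : ℤ) :
    ((P y).restrict {ω | ω 0 = y ∧ ω 1 = z}).map pathShift =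
      ENNReal.ofReal (urnStep lam y z) • P z := by
  have := hP.1 y
  have := hP.1 z
  have hcyl : {ω : ℕ → ℤ | ω 0 = y ∧ ω 1 = z} = cylinderSet 1 (fun i => if i = 0 then y else z) := by
    ext ω
    simp only [cylinderSet, Set.mem_ofPred_eq]
    constructor
    · rintro ⟨h1, h2⟩ i hi
      interval_cases i <;> simpa
    · intro h
      exact ⟨by simpa using h 0 (by simp), by simpa using h 1 (by simp)⟩
  refine ext_of_generate_finite cylinderSets generateFrom_cylinderSets isPiSystem_cylinderSets
    ?_ ?_
  · rintro s (rfl | ⟨n, p, rfl⟩)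
    · simp
    rw [Measure.map_apply measurable_pathShift (measurableSet_cylinderSet _ _),
      Measure.restrict_apply (measurable_pathShift (measurableSet_cylinderSet _ _)),
      Measure.smul_apply, hP.measure_cylinderSet z, smul_eq_mul]
    by_cases hz : p 0 = z
    · have hset : pathShift ⁻¹' cylinderSet n p ∩ {ω | ω 0 = y ∧ ω 1 = z} =
          cylinderSet (n + 1) (fun i => if i = 0 then y else p (i - 1)) := by
        ext ω
        simp only [cylinderSet, pathShift, Set.mem_inter_iff, Set.mem_preimage, Set.mem_ofPred_eq]
        constructor
        · rintro ⟨h1, h2, -⟩ i hi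
          rcases i with _ | i
          · simpa using h2
          · simpa using h1 i (by omega)
        · intro h
          refine ⟨fun i hi => by simpa using h (i + 1) (by omega), by simpa using h 0 (by omega),
            by simpa [hz] using h 1 (by omega)⟩
      rw [hset, hP.measure_cylinderSet, ← ENNReal.ofReal_mul (urnStep_nonneg h0 _ _),
        Finset.prod_range_succ']
      simp [hz, mul_comm]
    · have hset : pathShift ⁻¹' cylinderSet n p ∩ {ω | ω 0 = y ∧ ω 1 = z} = ∅ := by
        ext ω
        simp only [cylinderSet, pathShift, Set.mem_inter_iff, Set.mem_preimage, Set.mem_ofPred_eq,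
          Set.mem_empty_iff_false, iff_false]
        rintro ⟨h1, -, h2⟩
        exact hz ((h1 0 (Nat.zero_le _)).symm.trans h2)
      simp [hset, hz]
  · rw [Measure.map_apply measurable_pathShift MeasurableSet.univ, hcyl]
    simp [hP.measure_cylinderSet]

lemma IsUrnChain.measureReal_shift (h0 : 0 < lam) (hP : IsUrnChain lam P) (y z : ℤ)
    {A : Set (ℕ → ℤ)} (hA : MeasurableSet A) :
    (P y).real (pathShift ⁻¹' A ∩ {ω | ω 0 = y ∧ ω 1 = z}) =
      urnStep lam y z * (P z).real A := by
  have h := congrArg (fun μ => (μ A).toReal) (hP.map_pathShift h0 y z)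
  simp only [Measure.map_apply measurable_pathShift hA,
    Measure.restrict_apply (measurable_pathShift hA), Measure.smul_apply, smul_eq_mul,
    ENNReal.toReal_mul, ENNReal.toReal_ofReal (urnStep_nonneg h0 y z)] at h
  exact h

end Markov

section DownSteps

/-- The paths that make at least `m` down-steps and whose position right after the `m`-th one
(at time `0` if `m = 0`) is at least `-1`. -/
def aboveAtDown (m : ℕ) : Set (ℕ → ℤ) :=
  {ω | ∃ j, downCount ω j = m ∧ (∀ i < j, downCount ω i < m) ∧ -1 ≤ ω j}

@[simp] lemma downCount_zero (ω : ℕ → ℤ) : downCount ω 0 = 0 := by simp [downCount]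

lemma downCount_eq_sum (ω : ℕ → ℤ) (j : ℕ) :
    downCount ω j = ∑ i ∈ Finset.range j, if ω (i + 1) = ω i - 1 then 1 else 0 := by
  rw [downCount, Finset.card_filter, Finset.range_eq_Ico]
  exact (Finset.sum_Ico_add' (fun l => if ω l = ω (l - 1) - 1 then 1 else 0) 0 j 1).symm

lemma downCount_succ (ω : ℕ → ℤ) (j : ℕ) :
    downCount ω (j + 1) = downCount (pathShift ω) j + if ω 1 = ω 0 - 1 then 1 else 0 := by
  rw [downCount_eq_sum, downCount_eq_sum, Finset.sum_range_succ']
  rfl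

lemma measurable_downCount (j : ℕ) : Measurable fun ω => downCount ω j := by
  simp only [downCount_eq_sum]
  refine Finset.measurable_fun_sum _ fun i _ => ?_
  refine Measurable.ite ?_ measurable_const measurable_const
  exact measurableSet_eq_fun (measurable_pi_apply _) ((measurable_pi_apply i).sub_const 1)

lemma measurableSet_aboveAtDown (m : ℕ) : MeasurableSet (aboveAtDown m) := by
  have h : aboveAtDown m = ⋃ j, ({ω | downCount ω j = m} ∩
      ((⋂ i, ⋂ _ : i < j, {ω | downCount ω i < m}) ∩ {ω | -1 ≤ ω j})) := by
    ext ω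
    simp [aboveAtDown]
  rw [h]
  refine MeasurableSet.iUnion fun j => MeasurableSet.inter ?_ (MeasurableSet.inter ?_ ?_)
  · exact measurable_downCount j (measurableSet_singleton m)
  · exact MeasurableSet.iInter fun i => MeasurableSet.iInter fun _ =>
      measurable_downCount i measurableSet_Iio
  · exact measurable_pi_apply (X := fun _ : ℕ => ℤ) j measurableSet_Ici

lemma mem_aboveAtDown_of_up {ω : ℕ → ℤ} {m : ℕ} (h1 : ω 1 ≠ ω 0 - 1)
    (h : pathShift ω ∈ aboveAtDown (m + 1)) : ω ∈ aboveAtDown (m + 1) := by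
  obtain ⟨j, hj, hlt, hpos⟩ := h
  refine ⟨j + 1, by simp [downCount_succ, h1, hj], fun i hi => ?_, hpos⟩
  rcases i with _ | i
  · simp
  · simpa [downCount_succ, h1] using hlt i (by omega)

lemma mem_aboveAtDown_of_down {ω : ℕ → ℤ} {m : ℕ} (h1 : ω 1 = ω 0 - 1)
    (h : pathShift ω ∈ aboveAtDown m) : ω ∈ aboveAtDown (m + 1) := by
  obtain ⟨j, hj, hlt, hpos⟩ := h
  refine ⟨j + 1, by simp [downCount_succ, h1, hj], fun i hi => ?_, hpos⟩
  rcases i with _ | i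
  · simp
  · simpa [downCount_succ, h1] using hlt i (by omega)

lemma le_apply_betaTime {ω : ℕ → ℤ} {m : ℕ} (hm : 1 ≤ m) (h : ω ∈ aboveAtDown m) :
    -1 ≤ ω (betaTime ω m) := by
  obtain ⟨j, hj, hlt, hpos⟩ := h
  have hj1 : 1 ≤ j := by
    rcases j with _ | j
    · simp at hj
      omega
    · omega
  have hb : betaTime ω m = j := by
    refine le_antisymm (Nat.sInf_le ⟨hj1, hj⟩) (le_csInf ⟨j, hj1, hj⟩ ?_)
    rintro i ⟨-, hi⟩
    by_contra hij
    exact (hlt i (by omega)).ne hi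
  rwa [hb]

lemma IsUrnChain.measureReal_aboveAtDown_succ {lam : ℝ} {P : ℤ → Measure (ℕ → ℤ)}
    (h0 : 0 < lam) (hP : IsUrnChain lam P) (m : ℕ) (y : ℤ) :
    urnStep lam y (y + 1) * (P (y + 1)).real (aboveAtDown (m + 1)) +
      (1 - urnStep lam y (y + 1)) * (P (y - 1)).real (aboveAtDown m) ≤
      (P y).real (aboveAtDown (m + 1)) := by
  have := hP.1 y
  have hstep : ∀ z : ℤ, MeasurableSet {ω : ℕ → ℤ | ω 0 = y ∧ ω 1 = z} := fun z =>
    (measurable_pi_apply (X := fun _ : ℕ => ℤ) 0 (measurableSet_singleton y)).inter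
      (measurable_pi_apply (X := fun _ : ℕ => ℤ) 1 (measurableSet_singleton z))
  rw [← urnStep_down h0, ← hP.measureReal_shift h0 _ _ (measurableSet_aboveAtDown _),
    ← hP.measureReal_shift h0 _ _ (measurableSet_aboveAtDown _), ← measureReal_union]
  · refine measureReal_mono ?_
    rintro ω (⟨h, hy, hz⟩ | ⟨h, hy, hz⟩)
    · exact mem_aboveAtDown_of_up (by omega) h
    · exact mem_aboveAtDown_of_down (by omega) h
  · refine Set.disjoint_left.2 ?_
    rintro ω ⟨-, -, hz⟩ ⟨-, -, hz'⟩
    omega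
  · exact (measurable_pathShift (measurableSet_aboveAtDown _)).inter (hstep _)

lemma IsUrnChain.measureReal_aboveAtDown_zero {lam : ℝ} {P : ℤ → Measure (ℕ → ℤ)}
    (hP : IsUrnChain lam P) {y : ℤ} (hy : -1 ≤ y) : (P y).real (aboveAtDown 0) = 1 := by
  have := hP.1 y
  refine le_antisymm measureReal_le_one ?_
  have h : (P y).real (cylinderSet 0 fun _ => y) = 1 := by
    simp [measureReal_def, hP.measure_cylinderSet]
  rw [← h]
  refine measureReal_mono fun ω hω => ⟨0, by simp, by simp, ?_⟩
  rw [hω 0 le_rfl]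
  exact hy

end DownSteps

section Bounds

variable {lam : ℝ}

lemma urnStep_up_le (h0 : 0 < lam) (h1 : lam < 1) {a y : ℤ} (h : a ≤ y) :
    urnStep lam y (y + 1) ≤ urnStep lam a (a + 1) := by
  rw [urnStep_up, urnStep_up]
  have hy := zpow_pos h0 (2 * y - 1)
  have ha := zpow_pos h0 (2 * a - 1)
  have hle : lam ^ (2 * y - 1) ≤ lam ^ (2 * a - 1) :=
    zpow_le_zpow_right_of_le_one₀ h0 h1.le (by omega)
  rw [div_le_div_iff₀ (by positivity) (by positivity)]
  nlinarith

lemma urnStep_up_lt_one (h0 : 0 < lam) (a : ℤ) : urnStep lam a (a + 1) < 1 := by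
  have ha := zpow_pos h0 (2 * a - 1)
  rw [urnStep_up, div_lt_one (by positivity)]
  linarith

/-- A minimum principle: a function bounded below by `-1` that is superharmonic for the chain
killed at its first down-step is nonnegative. -/
lemma nonneg_of_urnStep_up_mul_le (h0 : 0 < lam) (h1 : lam < 1) {g : ℤ → ℝ} {a : ℤ}
    (hlow : ∀ y, -1 ≤ g y) (hg : ∀ y, a ≤ y → urnStep lam y (y + 1) * g (y + 1) ≤ g y) :
    0 ≤ g a := by
  set r := urnStep lam a (a + 1) with hr
  have hr0 : 0 ≤ r := urnStep_nonneg h0 _ _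
  have key : ∀ (n : ℕ) (y : ℤ), a ≤ y → -r ^ n ≤ g y := by
    intro n
    induction n with
    | zero => simpa using fun y _ => hlow y
    | succ n ih =>
      intro y hy
      have hp := urnStep_nonneg h0 y (y + 1)
      have hpr : urnStep lam y (y + 1) ≤ r := urnStep_up_le h0 h1 hy
      calc -r ^ (n + 1) = r * -r ^ n := by ring
        _ ≤ urnStep lam y (y + 1) * -r ^ n :=
          mul_le_mul_of_nonpos_right hpr (neg_nonpos.2 (pow_nonneg hr0 n))
        _ ≤ urnStep lam y (y + 1) * g (y + 1) :=
          mul_le_mul_of_nonneg_left (ih _ (by omega)) hp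
        _ ≤ g y := hg y hy
  have hlim : Tendsto (fun n : ℕ => -r ^ n) atTop (nhds 0) := by
    simpa using (tendsto_pow_atTop_nhds_zero_of_lt_one hr0 (urnStep_up_lt_one h0 a)).neg
  exact le_of_tendsto' hlim fun n => key n a le_rfl

lemma exp_neg_pow_le_urnStep_up (h0 : 0 < lam) (h1 : lam < 1) (n : ℕ) :
    Real.exp (-lam ^ n) ≤ urnStep lam (-(n + 1 : ℕ)) (-(n + 1 : ℕ) + 1) := by
  have hz : lam ^ (2 * (-((n + 1 : ℕ) : ℤ)) - 1) = (lam ^ (2 * n + 3))⁻¹ := by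
    rw [← zpow_natCast, ← zpow_neg]
    congr 1
  have hle : lam ^ (2 * n + 3) ≤ lam ^ n := pow_le_pow_of_le_one h0.le h1.le (by omega)
  have hpos : 0 < lam ^ (2 * n + 3) := pow_pos h0 _
  have heq : (lam ^ (2 * n + 3))⁻¹ / (1 + (lam ^ (2 * n + 3))⁻¹) = (1 + lam ^ (2 * n + 3))⁻¹ := by
    field_simp
    ring
  rw [urnStep_up, hz, heq, Real.exp_neg]
  refine inv_anti₀ (by positivity) ?_
  linarith [Real.add_one_le_exp (lam ^ n)]

variable {P : ℤ → Measure (ℕ → ℤ)}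

lemma IsUrnChain.exp_le_measureReal_aboveAtDown_one (h0 : 0 < lam) (h1 : lam < 1)
    (hP : IsUrnChain lam P) (y : ℤ) :
    Real.exp (-(1 - lam)⁻¹) ≤ (P y).real (aboveAtDown 1) := by
  have hnonneg : ∀ a : ℤ, 0 ≤ a → 1 ≤ (P a).real (aboveAtDown 1) := by
    intro a ha
    have := nonneg_of_urnStep_up_mul_le h0 h1 (a := a)
      (g := fun y => (P y).real (aboveAtDown 1) - 1)
      (fun y => by linarith [measureReal_nonneg (μ := P y) (s := aboveAtDown 1)])
      (fun y hy => by
        have h := hP.measureReal_aboveAtDown_succ h0 0 y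
        rw [hP.measureReal_aboveAtDown_zero (show -1 ≤ y - 1 by omega)] at h
        simp only [zero_add] at h
        linarith)
    linarith
  have hneg : ∀ n : ℕ, Real.exp (-∑ l ∈ Finset.range n, lam ^ l) ≤
      (P (-(n : ℤ))).real (aboveAtDown 1) := by
    intro n
    induction n with
    | zero => simpa using hnonneg 0 le_rfl
    | succ n ih =>
      have h := hP.measureReal_aboveAtDown_succ h0 0 (-((n + 1 : ℕ) : ℤ))
      have hp := exp_neg_pow_le_urnStep_up h0 h1 n
      have hq := urnStep_up_lt_one h0 (-((n + 1 : ℕ) : ℤ))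
      have hmul := mul_le_mul hp ih (Real.exp_nonneg _) (urnStep_nonneg h0 _ _)
      have hrest := mul_nonneg (sub_nonneg.2 hq.le) (measureReal_nonneg
        (μ := P (-((n + 1 : ℕ) : ℤ) - 1)) (s := aboveAtDown 0))
      rw [show -(n : ℤ) = -((n + 1 : ℕ) : ℤ) + 1 by push_cast; ring, ← Real.exp_add] at hmul
      rw [Finset.sum_range_succ, neg_add_rev]
      simp only [zero_add] at h
      linarith
  rcases le_total 0 y with hy | hy
  · refine le_trans ?_ (hnonneg y hy)
    rw [Real.exp_le_one_iff, neg_nonpos, inv_nonneg]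
    linarith
  · obtain ⟨n, rfl⟩ := Int.exists_eq_neg_ofNat hy
    refine le_trans (Real.exp_le_exp.2 (neg_le_neg ?_)) (hneg n)
    rw [← tsum_geometric_of_lt_one h0.le h1]
    exact (summable_geometric_of_lt_one h0.le h1).sum_le_tsum _ fun l _ => pow_nonneg h0.le l

lemma IsUrnChain.exp_le_measureReal_aboveAtDown (h0 : 0 < lam) (h1 : lam < 1)
    (hP : IsUrnChain lam P) {m : ℕ} (hm : 1 ≤ m) (y : ℤ) :
    Real.exp (-(1 - lam)⁻¹) ≤ (P y).real (aboveAtDown m) := by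
  have hc1 : Real.exp (-(1 - lam)⁻¹) ≤ 1 := by
    rw [Real.exp_le_one_iff, neg_nonpos, inv_nonneg]
    linarith
  induction m, hm using Nat.le_induction generalizing y with
  | base => exact hP.exp_le_measureReal_aboveAtDown_one h0 h1 y
  | succ m hm ih =>
    have := nonneg_of_urnStep_up_mul_le h0 h1 (a := y)
      (g := fun y => (P y).real (aboveAtDown (m + 1)) - Real.exp (-(1 - lam)⁻¹))
      (fun y => by linarith [measureReal_nonneg (μ := P y) (s := aboveAtDown (m + 1))])
      (fun y _ => by
        have h := hP.measureReal_aboveAtDown_succ h0 m y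
        have hq := mul_le_mul_of_nonneg_left (ih (y - 1))
          (sub_nonneg.2 (urnStep_up_lt_one h0 y).le)
        linarith)
    linarith

end Bounds

/-- Uniform lower bound: `inf_{b,m ≥ 1, k < -b} P_k(𝔇_{β_m} ≥ k + b) > 0`. -/
theorem urn_beta_unif_lower (lam : ℝ) (hlam : lam ∈ Set.Ioo (0 : ℝ) 1)
    (P : ℤ → Measure (ℕ → ℤ)) (hP : IsUrnChain lam P) :
    ∃ ε > (0 : ℝ), ∀ (b m : ℕ), 1 ≤ b → 1 ≤ m → ∀ k : ℤ, k < -(b : ℤ) →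
      ε ≤ (P k {ω | k + (b : ℤ) ≤ ω (betaTime ω m)}).toReal := by
  refine ⟨Real.exp (-(1 - lam)⁻¹), Real.exp_pos _, fun b m _ hm k hk => ?_⟩
  have := hP.1 k
  refine (hP.exp_le_measureReal_aboveAtDown hlam.1 hlam.2 hm k).trans (measureReal_mono ?_)
  intro ω hω
  have := le_apply_betaTime hm hω
  simp only [Set.mem_ofPred_eq]
  omega
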